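/- The algebra map Θ: B(p;q) → A(p;q) determined by x ↦ x₋z₊, y ↦ z₋x₊, z ↦ z₋z₊ is well defined (it respects the defining relations of B(p;q)) and is an algebra isomorphism of B(p;q) onto the degree-zero component A(p;q)₀ of the ℤ-graded algebra A(p;q). -/

import Mathlib

noncomputable section

open Polynomial
open scoped Classical

namespace GWAPaper

variable (K : Type) [Field K]

/-- Defining relations of the generalized Weyl algebra `A(p;q)`; the generators are
indexed by `Fin 4` with `0 ↦ x₊`, `1 ↦ x₋`, `2 ↦ z₊`, `3 ↦ z₋`. -/
inductive GWARel (q : K) (p : K[X]) :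
    FreeAlgebra K (Fin 4) → FreeAlgebra K (Fin 4) → Prop
  | zz : GWARel q p (FreeAlgebra.ι K (2 : Fin 4) * FreeAlgebra.ι K (3 : Fin 4))
      (FreeAlgebra.ι K (3 : Fin 4) * FreeAlgebra.ι K (2 : Fin 4))
  | xpzp : GWARel q p (FreeAlgebra.ι K (0 : Fin 4) * FreeAlgebra.ι K (2 : Fin 4))
      (q⁻¹ • (FreeAlgebra.ι K (2 : Fin 4) * FreeAlgebra.ι K (0 : Fin 4)))
  | xpzm : GWARel q p (FreeAlgebra.ι K (0 : Fin 4) * FreeAlgebra.ι K (3 : Fin 4))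
      (q⁻¹ • (FreeAlgebra.ι K (3 : Fin 4) * FreeAlgebra.ι K (0 : Fin 4)))
  | xmzp : GWARel q p (FreeAlgebra.ι K (1 : Fin 4) * FreeAlgebra.ι K (2 : Fin 4))
      (q • (FreeAlgebra.ι K (2 : Fin 4) * FreeAlgebra.ι K (1 : Fin 4)))
  | xmzm : GWARel q p (FreeAlgebra.ι K (1 : Fin 4) * FreeAlgebra.ι K (3 : Fin 4))
      (q • (FreeAlgebra.ι K (3 : Fin 4) * FreeAlgebra.ι K (1 : Fin 4)))
  | xpxm : GWARel q p (FreeAlgebra.ι K (0 : Fin 4) * FreeAlgebra.ι K (1 : Fin 4))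
      (Polynomial.aeval (FreeAlgebra.ι K (2 : Fin 4) * FreeAlgebra.ι K (3 : Fin 4)) p)
  | xmxp : GWARel q p (FreeAlgebra.ι K (1 : Fin 4) * FreeAlgebra.ι K (0 : Fin 4))
      (Polynomial.aeval ((q ^ 2 : K) • (FreeAlgebra.ι K (3 : Fin 4) * FreeAlgebra.ι K (2 : Fin 4))) p)

/-- The generalized Weyl algebra `A(p;q)`. -/
abbrev GWA (q : K) (p : K[X]) : Type := RingQuot (GWARel K q p)

/-- The images of the four generators in `A(p;q)`. -/
def gwaGen (q : K) (p : K[X]) (i : Fin 4) : GWA K q p :=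
  RingQuot.mkAlgHom K (GWARel K q p) (FreeAlgebra.ι K i)

/-- The generator `x₊`. -/
def xp (q : K) (p : K[X]) : GWA K q p := gwaGen K q p 0
/-- The generator `x₋`. -/
def xm (q : K) (p : K[X]) : GWA K q p := gwaGen K q p 1
/-- The generator `z₊`. -/
def zp (q : K) (p : K[X]) : GWA K q p := gwaGen K q p 2
/-- The generator `z₋`. -/
def zm (q : K) (p : K[X]) : GWA K q p := gwaGen K q p 3

/-- ℤ-degrees of the generators: `deg x₊ = deg z₊ = 1`, `deg x₋ = deg z₋ = -1`. -/
def gwaWt : Fin 4 → ℤ := ![1, -1, 1, -1]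

/-- The total degree of a word in the generators. -/
def wordDeg (w : List (Fin 4)) : ℤ := (w.map gwaWt).sum

/-- The product in `A(p;q)` of the letters of a word. -/
def wordVal (q : K) (p : K[X]) (w : List (Fin 4)) : GWA K q p :=
  (w.map (gwaGen K q p)).prod

/-- The degree-`n` homogeneous component of the ℤ-graded algebra `A(p;q)`:
the `K`-linear span of the values of all words of total degree `n`. -/
def component (q : K) (p : K[X]) (n : ℤ) : Submodule K (GWA K q p) :=
  Submodule.span K {a | ∃ w : List (Fin 4), wordDeg w = n ∧ wordVal K q p w = a}

/-- The `q²`-derivative `p_{q²}` of a polynomial `p`, equal to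
`(p(q²z) - p(z))/((q²-1)z)` if `q² ≠ 1` and to `p'` if `q² = 1`. -/
def qDeriv (q : K) (p : K[X]) : K[X] :=
  if q ^ 2 = 1 then derivative p
  else (p.comp (C (q ^ 2) * X) - p) / (C (q ^ 2 - 1) * X)

/-- The polynomial `c(z) = q·p_{q²}(z)`. -/
def cPoly (q : K) (p : K[X]) : K[X] := C q * qDeriv K q p

/-- `p` is `q²`-separable: `p(z)` is coprime with `z·p_{q²}(z)`. -/
def QSeparable (q : K) (p : K[X]) : Prop := IsCoprime p (X * qDeriv K q p)

/-- Defining relations of the algebra `B(p;q)`; the generators are indexed by `Fin 3`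
with `0 ↦ x`, `1 ↦ y`, `2 ↦ z`. -/
inductive GWBRel (q : K) (p : K[X]) : FreeAlgebra K (Fin 3) → FreeAlgebra K (Fin 3) → Prop
  | xz : GWBRel q p (FreeAlgebra.ι K (0 : Fin 3) * FreeAlgebra.ι K (2 : Fin 3))
      ((q ^ 2) • (FreeAlgebra.ι K (2 : Fin 3) * FreeAlgebra.ι K (0 : Fin 3)))
  | yz : GWBRel q p (FreeAlgebra.ι K (1 : Fin 3) * FreeAlgebra.ι K (2 : Fin 3))
      ((q ^ 2)⁻¹ • (FreeAlgebra.ι K (2 : Fin 3) * FreeAlgebra.ι K (1 : Fin 3)))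
  | xy : GWBRel q p (FreeAlgebra.ι K (0 : Fin 3) * FreeAlgebra.ι K (1 : Fin 3))
      ((q ^ 2) • (FreeAlgebra.ι K (2 : Fin 3) *
        Polynomial.aeval ((q ^ 2 : K) • FreeAlgebra.ι K (2 : Fin 3)) p))
  | yx : GWBRel q p (FreeAlgebra.ι K (1 : Fin 3) * FreeAlgebra.ι K (0 : Fin 3))
      (FreeAlgebra.ι K (2 : Fin 3) * Polynomial.aeval (FreeAlgebra.ι K (2 : Fin 3)) p)

/-- The generalized Weyl algebra `B(p;q)`. -/
abbrev GWB (q : K) (p : K[X]) : Type := RingQuot (GWBRel K q p)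

/-- The generator `x` of `B(p;q)`. -/
def bX (q : K) (p : K[X]) : GWB K q p := RingQuot.mkAlgHom K (GWBRel K q p) (FreeAlgebra.ι K 0)
/-- The generator `y` of `B(p;q)`. -/
def bY (q : K) (p : K[X]) : GWB K q p := RingQuot.mkAlgHom K (GWBRel K q p) (FreeAlgebra.ι K 1)
/-- The generator `z` of `B(p;q)`. -/
def bZ (q : K) (p : K[X]) : GWB K q p := RingQuot.mkAlgHom K (GWBRel K q p) (FreeAlgebra.ι K 2)


variable {K}

section General

variable {R : Type*} [Ring R] [Algebra K R]

theorem semiconjBy_aeval {a z z' : R} (h : SemiconjBy a z z') (f : K[X]) :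
    SemiconjBy a (aeval z f) (aeval z' f) := by
  induction f using Polynomial.induction_on' with
  | add f g hf hg => simpa only [map_add] using hf.add_right hg
  | monomial n c =>
    simp only [aeval_monomial]
    exact SemiconjBy.mul_right (Algebra.commutes c a).symm (h.pow_right n)

theorem pow_mul_pow_mem {S : Subalgebra K R} {a b : R} {c : K}
    (hab : a * b ∈ S) (h : a * b = c • (b * a)) (k : ℕ) : a ^ k * b ^ k ∈ S := by
  induction k with
  | zero => simp [S.one_mem]
  | succ k ih =>
    have hs : SemiconjBy b ((c • a) ^ k) (a ^ k) :=
      SemiconjBy.pow_right (by simp [SemiconjBy, h]) k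
    by_cases hc : c = 0
    · have : a * b = 0 := by simp [h, hc]
      have : a ^ (k + 1) * b ^ (k + 1) = 0 := by
        rw [pow_succ, pow_succ', mul_assoc, ← mul_assoc a b, this]; simp
      simp [this, S.zero_mem]
    · have : a ^ (k + 1) * b ^ (k + 1) = (c ^ k) • ((a * b) * (a ^ k * b ^ k)) := by
        rw [pow_succ' a, pow_succ' b, mul_assoc a, ← mul_assoc (a ^ k), ← hs.eq, _root_.smul_pow]
        simp [mul_assoc]
      rw [this]
      exact S.smul_mem (S.mul_mem hab ih) _

/-- The two-sided sequence of powers `…, v ^ 2, v, 1, u, u ^ 2, …`. -/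
def zigzag (u v : R) : ℤ → R
  | Int.ofNat k => u ^ k
  | Int.negSucc k => v ^ (k + 1)

theorem zigzag_natCast (u v : R) (k : ℕ) : zigzag u v k = u ^ k := rfl

theorem zigzag_neg_natCast (u v : R) (k : ℕ) : zigzag u v (-k) = v ^ k := by
  cases k with
  | zero => exact (pow_zero u).trans (pow_zero v).symm
  | succ k => rfl

theorem mul_zigzag_of_nonneg (u v : R) {n : ℤ} (hn : 0 ≤ n) :
    u * zigzag u v n = zigzag u v (n + 1) := by
  lift n to ℕ using hn
  exact_mod_cast (pow_succ' u n).symm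

theorem mul_zigzag_of_neg (u v : R) {n : ℤ} (hn : n < 0) :
    u * zigzag u v n = u * v * zigzag u v (n + 1) := by
  obtain ⟨k, rfl⟩ : ∃ k : ℕ, n = -((k + 1 : ℕ) : ℤ) := ⟨(-n - 1).toNat, by omega⟩
  have : -((k + 1 : ℕ) : ℤ) + 1 = -(k : ℤ) := by push_cast; ring
  rw [this, zigzag_neg_natCast, zigzag_neg_natCast, pow_succ', mul_assoc]

theorem zigzag_neg (u v : R) (n : ℤ) : zigzag u v (-n) = zigzag v u n := by
  obtain ⟨k, rfl | rfl⟩ := n.eq_nat_or_neg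
  · rw [zigzag_neg_natCast, zigzag_natCast]
  · rw [neg_neg, zigzag_neg_natCast, zigzag_natCast]

theorem mul_zigzag_of_nonpos (u v : R) {n : ℤ} (hn : n ≤ 0) :
    v * zigzag u v n = zigzag u v (n - 1) := by
  rw [← zigzag_neg v u, mul_zigzag_of_nonneg v u (by omega), ← zigzag_neg v u]
  congr 1; ring

theorem mul_zigzag_of_pos (u v : R) {n : ℤ} (hn : 0 < n) :
    v * zigzag u v n = v * u * zigzag u v (n - 1) := by
  rw [← zigzag_neg v u, mul_zigzag_of_neg v u (by omega), ← zigzag_neg v u (n - 1)]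
  congr 2; ring

end General

section Relations

variable (q : K) (p : K[X])

theorem zp_mul_zm : zp K q p * zm K q p = zm K q p * zp K q p := by
  simpa [xp, xm, zp, zm, gwaGen] using
    RingQuot.mkAlgHom_rel K (GWARel.zz (q := q) (p := p))

theorem xp_mul_zp : SemiconjBy (xp K q p) (zp K q p) (q⁻¹ • zp K q p) := by
  simpa [SemiconjBy, xp, xm, zp, zm, gwaGen] using
    RingQuot.mkAlgHom_rel K (GWARel.xpzp (q := q) (p := p))

theorem xp_mul_zm : SemiconjBy (xp K q p) (zm K q p) (q⁻¹ • zm K q p) := by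
  simpa [SemiconjBy, xp, xm, zp, zm, gwaGen] using
    RingQuot.mkAlgHom_rel K (GWARel.xpzm (q := q) (p := p))

theorem xm_mul_zp : SemiconjBy (xm K q p) (zp K q p) (q • zp K q p) := by
  simpa [SemiconjBy, xp, xm, zp, zm, gwaGen] using
    RingQuot.mkAlgHom_rel K (GWARel.xmzp (q := q) (p := p))

theorem xm_mul_zm : SemiconjBy (xm K q p) (zm K q p) (q • zm K q p) := by
  simpa [SemiconjBy, xp, xm, zp, zm, gwaGen] using
    RingQuot.mkAlgHom_rel K (GWARel.xmzm (q := q) (p := p))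

theorem xp_mul_xm : xp K q p * xm K q p = aeval (zm K q p * zp K q p) p := by
  rw [← zp_mul_zm]
  simpa [← aeval_algHom_apply, xp, xm, zp, zm, gwaGen] using
    RingQuot.mkAlgHom_rel K (GWARel.xpxm (q := q) (p := p))

theorem xm_mul_xp : xm K q p * xp K q p = aeval ((q ^ 2) • (zm K q p * zp K q p)) p := by
  simpa [← aeval_algHom_apply, xp, xm, zp, zm, gwaGen] using
    RingQuot.mkAlgHom_rel K (GWARel.xmxp (q := q) (p := p))

theorem xm_mul_zm_mul_zp :
    SemiconjBy (xm K q p) (zm K q p * zp K q p) ((q ^ 2) • (zm K q p * zp K q p)) := by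
  have := (xm_mul_zm q p).mul_right (xm_mul_zp q p)
  rwa [smul_mul_smul_comm, ← pow_two] at this

theorem xp_mul_zm_mul_zp :
    SemiconjBy (xp K q p) (zm K q p * zp K q p) ((q ^ 2)⁻¹ • (zm K q p * zp K q p)) := by
  have := (xp_mul_zm q p).mul_right (xp_mul_zp q p)
  rwa [smul_mul_smul_comm, ← pow_two, inv_pow] at this

theorem commute_zp_zm_mul_zp : Commute (zp K q p) (zm K q p * zp K q p) :=
  Commute.mul_right (zp_mul_zm q p) rfl

theorem commute_zm_zm_mul_zp : Commute (zm K q p) (zm K q p * zp K q p) :=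
  Commute.mul_right rfl (zp_mul_zm q p).symm

theorem bX_mul_bZ : SemiconjBy (bX K q p) (bZ K q p) ((q ^ 2) • bZ K q p) := by
  simpa [SemiconjBy, bX, bY, bZ] using
    RingQuot.mkAlgHom_rel K (GWBRel.xz (q := q) (p := p))

theorem bY_mul_bZ : SemiconjBy (bY K q p) (bZ K q p) ((q ^ 2)⁻¹ • bZ K q p) := by
  simpa [SemiconjBy, bX, bY, bZ] using
    RingQuot.mkAlgHom_rel K (GWBRel.yz (q := q) (p := p))

theorem bX_mul_bY :
    bX K q p * bY K q p = (q ^ 2) • (bZ K q p * aeval ((q ^ 2) • bZ K q p) p) := by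
  simpa [← aeval_algHom_apply, bX, bY, bZ] using
    RingQuot.mkAlgHom_rel K (GWBRel.xy (q := q) (p := p))

theorem bY_mul_bX : bY K q p * bX K q p = bZ K q p * aeval (bZ K q p) p := by
  simpa [← aeval_algHom_apply, bX, bY, bZ] using
    RingQuot.mkAlgHom_rel K (GWBRel.yx (q := q) (p := p))

end Relations

section Theta

variable (q : K) (p : K[X])

/-- The algebra map `Θ : B(p;q) → A(p;q)`. -/
def theta : GWB K q p →ₐ[K] GWA K q p :=
  RingQuot.liftAlgHom K ⟨FreeAlgebra.lift K
    ![xm K q p * zp K q p, zm K q p * xp K q p, zm K q p * zp K q p], by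
    intro a b h
    cases h with
    | xz =>
      have := (xm_mul_zm_mul_zp q p).mul_left (commute_zp_zm_mul_zp q p)
      simpa [SemiconjBy] using this.eq
    | yz =>
      have h2 : SemiconjBy (zm K q p) ((q ^ 2)⁻¹ • (zm K q p * zp K q p))
          ((q ^ 2)⁻¹ • (zm K q p * zp K q p)) :=
        (commute_zm_zm_mul_zp q p).smul_right _
      have := h2.mul_left (xp_mul_zm_mul_zp q p)
      simpa [SemiconjBy] using this.eq
    | xy =>
      have : xm K q p * zp K q p * (zm K q p * xp K q p) =
          xm K q p * (zm K q p * zp K q p) * xp K q p := by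
        simp only [mul_assoc, ← zp_mul_zm]
      simp [← aeval_algHom_apply, this, (xm_mul_zm_mul_zp q p).eq]
      rw [mul_assoc (zm K q p * zp K q p), xm_mul_xp]
    | yx =>
      have : zm K q p * xp K q p * (xm K q p * zp K q p) =
          zm K q p * (aeval (zm K q p * zp K q p) p * zp K q p) := by
        rw [← xp_mul_xm]; simp only [mul_assoc]
      simp [← aeval_algHom_apply, this]
      rw [← (semiconjBy_aeval (commute_zp_zm_mul_zp q p) p).eq, mul_assoc]⟩

theorem theta_bX : theta q p (bX K q p) = xm K q p * zp K q p := by simp [theta, bX]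

theorem theta_bY : theta q p (bY K q p) = zm K q p * xp K q p := by simp [theta, bY]

theorem theta_bZ : theta q p (bZ K q p) = zm K q p * zp K q p := by simp [theta, bZ]

end Theta

section NormalForm

variable (q : K) (p : K[X])

/-- The linear map sending the coefficient family `f` to `∑ₙ fₙ(z) wₙ`, where `wₙ = yⁿ` and
`w₋ₙ = xⁿ` for `n ≥ 0`. -/
def normalForm : (ℤ →₀ K[X]) →ₗ[K] GWB K q p :=
  Finsupp.lsum K fun n =>
    LinearMap.mulRight K (zigzag (bY K q p) (bX K q p) n) ∘ₗ (aeval (bZ K q p)).toLinearMap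

theorem normalForm_single (n : ℤ) (f : K[X]) :
    normalForm q p (Finsupp.single n f) =
      aeval (bZ K q p) f * zigzag (bY K q p) (bX K q p) n := by
  simp [normalForm]

theorem aeval_smul_mem_range_aeval {R : Type*} [Ring R] [Algebra K R] (z : R) (c : K)
    (f : K[X]) : aeval (c • z) f ∈ (aeval (R := K) z).range :=
  ⟨f.comp (C c * X), by simp [aeval_comp, Algebra.smul_def]⟩

theorem mul_zigzag_mem_range_normalForm {a : GWB K q p}
    (ha : a ∈ (aeval (R := K) (bZ K q p)).range) (n : ℤ) :
    a * zigzag (bY K q p) (bX K q p) n ∈ LinearMap.range (normalForm q p) := by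
  obtain ⟨f, rfl⟩ := ha
  exact ⟨Finsupp.single n f, normalForm_single q p n f⟩

theorem mul_mem_range_normalForm (i : Fin 3) {b : GWB K q p}
    (hb : b ∈ LinearMap.range (normalForm q p)) :
    RingQuot.mkAlgHom K (GWBRel K q p) (FreeAlgebra.ι K i) * b ∈
      LinearMap.range (normalForm q p) := by
  have hz : bZ K q p ∈ (aeval (R := K) (bZ K q p)).range := ⟨X, by simp⟩
  have haev (f : K[X]) : aeval (bZ K q p) f ∈ (aeval (R := K) (bZ K q p)).range := ⟨f, rfl⟩
  obtain ⟨F, rfl⟩ := hb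
  induction F using Finsupp.induction_linear with
  | zero => simp
  | add F G hF hG => rw [map_add, mul_add]; exact add_mem hF hG
  | single n f =>
    rw [normalForm_single, ← mul_assoc]
    fin_cases i
    · change bX K q p * _ * _ ∈ _
      rw [(semiconjBy_aeval (bX_mul_bZ q p) f).eq, mul_assoc]
      obtain hn | hn := le_or_gt n 0
      · rw [mul_zigzag_of_nonpos _ _ hn]
        exact mul_zigzag_mem_range_normalForm q p (aeval_smul_mem_range_aeval _ _ _) _
      · rw [mul_zigzag_of_pos _ _ hn, bX_mul_bY, ← mul_assoc]
        exact mul_zigzag_mem_range_normalForm q p (mul_mem (aeval_smul_mem_range_aeval _ _ _)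
          (Subalgebra.smul_mem _ (mul_mem hz (aeval_smul_mem_range_aeval _ _ _)) _)) _
    · change bY K q p * _ * _ ∈ _
      rw [(semiconjBy_aeval (bY_mul_bZ q p) f).eq, mul_assoc]
      obtain hn | hn := le_or_gt 0 n
      · rw [mul_zigzag_of_nonneg _ _ hn]
        exact mul_zigzag_mem_range_normalForm q p (aeval_smul_mem_range_aeval _ _ _) _
      · rw [mul_zigzag_of_neg _ _ hn, bY_mul_bX, ← mul_assoc]
        exact mul_zigzag_mem_range_normalForm q p (mul_mem (aeval_smul_mem_range_aeval _ _ _)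
          (mul_mem hz (haev p))) _
    · change bZ K q p * _ * _ ∈ _
      exact mul_zigzag_mem_range_normalForm q p (mul_mem hz (haev f)) _

theorem normalForm_surjective : Function.Surjective (normalForm q p) := by
  intro b
  obtain ⟨a, rfl⟩ := RingQuot.mkAlgHom_surjective K (GWBRel K q p) b
  have key : ∀ b ∈ LinearMap.range (normalForm q p),
      RingQuot.mkAlgHom K (GWBRel K q p) a * b ∈ LinearMap.range (normalForm q p) := by
    induction a using FreeAlgebra.induction with
    | grade0 r =>
      intro b hb
      rw [AlgHom.commutes, ← Algebra.smul_def]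
      exact Submodule.smul_mem _ r hb
    | grade1 i => exact fun b hb => mul_mem_range_normalForm q p i hb
    | mul a a' h h' =>
      intro b hb
      rw [map_mul, mul_assoc]
      exact h _ (h' _ hb)
    | add a a' h h' =>
      intro b hb
      rw [map_add, add_mul]
      exact add_mem (h _ hb) (h' _ hb)
  simpa using key 1 ⟨Finsupp.single 0 1, by simp [normalForm_single, zigzag]⟩

end NormalForm

section Representation

/-- The weighted shift `(S f)ₘ = wₘ · f_{m + d}(cX)` on sequences of polynomials. -/
def weightedShift (c : K) (w : ℤ → K[X]) (d : ℤ) : Module.End K (ℤ → K[X]) where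
  toFun f m := w m * aeval (C c * X) (f (m + d))
  map_add' f g := by ext1 m; simp [mul_add]
  map_smul' r f := by ext1 m; simp

theorem weightedShift_apply (c : K) (w : ℤ → K[X]) (d : ℤ) (f : ℤ → K[X]) (m : ℤ) :
    weightedShift c w d f m = w m * aeval (C c * X) (f (m + d)) := rfl

theorem weightedShift_single (c : K) (w : ℤ → K[X]) (d n : ℤ) (u : K[X]) :
    weightedShift c w d (Pi.single n u) =
      Pi.single (n - d) (w (n - d) * aeval (C c * X) u) := by
  ext1 m
  rw [weightedShift_apply]
  obtain rfl | hm := eq_or_ne m (n - d)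
  · simp
  · have : m + d ≠ n := fun h => hm (by omega)
    simp [hm, this]

theorem aeval_C_mul_X_ne_zero {c : K} (hc : c ≠ 0) {u : K[X]} (hu : u ≠ 0) :
    aeval (C c * X) u ≠ 0 := by
  have h : aeval (C c⁻¹ * X) (aeval (C c * X) u) = u := by
    rw [← aeval_algHom_apply]
    simp [← mul_assoc, ← C_mul, hc]
  intro h0
  rw [h0, map_zero] at h
  exact hu h.symm

variable (q : K) (p : K[X])

/-- The operator representing `x₊`. -/
def raisingOp : Module.End K (ℤ → K[X]) :=
  weightedShift q⁻¹ (fun m => if 1 ≤ m then 1 else aeval (X * X) p) (-1)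

/-- The operator representing `x₋`. -/
def loweringOp : Module.End K (ℤ → K[X]) :=
  weightedShift q (fun m => if m ≤ -1 then 1 else aeval ((q ^ 2) • (X * X : K[X])) p) 1

variable {q}

/-- The representation of `A(p;q)` on sequences of polynomials in which both `z₊` and `z₋` act as
multiplication by the variable. -/
def rep (hq : q ≠ 0) : GWA K q p →ₐ[K] Module.End K (ℤ → K[X]) :=
  RingQuot.liftAlgHom K ⟨FreeAlgebra.lift K
    ![raisingOp q p, loweringOp q p, Algebra.lsmul K K (ℤ → K[X]) (X : K[X]),
      Algebra.lsmul K K (ℤ → K[X]) (X : K[X])], by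
    intro a b h
    have hp : aeval (C q * X : K[X]) (aeval (X * X : K[X]) p) = aeval ((q ^ 2) • (X * X : K[X])) p := by
      rw [← aeval_algHom_apply]
      congr 2
      simp [smul_eq_C_mul]; ring
    have hp' : aeval (C q⁻¹ * X : K[X]) (aeval ((q ^ 2) • (X * X : K[X])) p) = aeval (X * X : K[X]) p := by
      rw [← aeval_algHom_apply]
      congr 2
      have : C q * C q⁻¹ = 1 := by rw [← C_mul, mul_inv_cancel₀ hq, C_1]
      simp only [map_mul, aeval_X, smul_eq_C_mul, map_pow, aeval_C, algebraMap_eq]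
      linear_combination (C q * C q⁻¹ + 1) * X * X * this
    have hc (c : K) (f : K[X]) : aeval (C c * X : K[X]) (aeval (C c⁻¹ * X : K[X]) f) = f ∨ c = 0 := by
      by_cases h : c = 0
      · exact .inr h
      · left
        rw [← aeval_algHom_apply]
        simp [← mul_assoc, ← C_mul, h]
    have h1 (f : K[X]) : aeval (C q * X : K[X]) (aeval (C q⁻¹ * X : K[X]) f) = f :=
      (hc q f).resolve_right hq
    have h2 (f : K[X]) : aeval (C q⁻¹ * X : K[X]) (aeval (C q * X : K[X]) f) = f := by
      simpa using (hc q⁻¹ f).resolve_right (inv_ne_zero hq)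
    cases h with
    | zz => simp
    | xpzp | xpzm | xmzp | xmzm =>
      ext1 f; ext1 m
      simp [raisingOp, loweringOp, weightedShift_apply, smul_eq_C_mul]
      ring_nf
    | xpxm =>
      simp only [← aeval_algHom_apply, map_mul, FreeAlgebra.lift_ι_apply]
      simp only [Matrix.cons_val, ← map_mul, aeval_algHom_apply]
      ext1 f; ext1 m
      by_cases hm : 1 ≤ m
      · have : ¬ m ≤ 0 := by omega
        simp [raisingOp, loweringOp, weightedShift_apply, hm, h2, hp', this]
      · have : m ≤ 0 := by omega
        simp [raisingOp, loweringOp, weightedShift_apply, hm, h2, this]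
    | xmxp =>
      simp only [← aeval_algHom_apply, map_mul, map_smul, FreeAlgebra.lift_ι_apply]
      simp only [Matrix.cons_val, ← map_mul, ← map_smul, aeval_algHom_apply]
      ext1 f; ext1 m
      by_cases hm : m ≤ -1
      · have : ¬ 0 ≤ m := by omega
        simp [raisingOp, loweringOp, weightedShift_apply, hm, h1, hp, this]
      · have : 0 ≤ m := by omega
        simp [raisingOp, loweringOp, weightedShift_apply, hm, h1, this]⟩

variable (hq : q ≠ 0)

theorem rep_xp : rep p hq (xp K q p) = raisingOp q p := by simp [rep, xp, gwaGen]

theorem rep_xm : rep p hq (xm K q p) = loweringOp q p := by simp [rep, xm, gwaGen]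

theorem rep_zp : rep p hq (zp K q p) = Algebra.lsmul K K (ℤ → K[X]) (X : K[X]) := by
  simp [rep, zp, gwaGen]

theorem rep_zm : rep p hq (zm K q p) = Algebra.lsmul K K (ℤ → K[X]) (X : K[X]) := by
  simp [rep, zm, gwaGen]

theorem rep_theta_aeval_bZ (f : K[X]) :
    rep p hq (theta q p (aeval (bZ K q p) f)) =
      Algebra.lsmul K K (ℤ → K[X]) (expand K 2 f) := by
  rw [← aeval_algHom_apply, ← aeval_algHom_apply, theta_bZ, map_mul, rep_zp, rep_zm, ← map_mul,
    aeval_algHom_apply, ← pow_two, ← expand_aeval, aeval_X_left_apply]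

theorem exists_rep_theta_zigzag (n : ℤ) :
    ∃ u : K[X], u ≠ 0 ∧
      rep p hq (theta q p (zigzag (bY K q p) (bX K q p) n)) (Pi.single 0 1) = Pi.single n u := by
  obtain ⟨k, rfl | rfl⟩ := n.eq_nat_or_neg
  · induction k with
    | zero => exact ⟨1, one_ne_zero, by simp [zigzag]⟩
    | succ k ih =>
      obtain ⟨u, hu, h⟩ := ih
      refine ⟨X * aeval (C q⁻¹ * X) u,
        mul_ne_zero X_ne_zero (aeval_C_mul_X_ne_zero (inv_ne_zero hq) hu), ?_⟩
      rw [zigzag_natCast] at h ⊢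
      rw [pow_succ', map_mul, map_mul, Module.End.mul_apply, h, theta_bY, map_mul, rep_xp, rep_zm,
        Module.End.mul_apply, raisingOp, weightedShift_single]
      simp [← Pi.single_smul]
  · induction k with
    | zero => exact ⟨1, one_ne_zero, by simp [zigzag]⟩
    | succ k ih =>
      obtain ⟨u, hu, h⟩ := ih
      refine ⟨aeval (C q * X) (X * u),
        aeval_C_mul_X_ne_zero hq (mul_ne_zero X_ne_zero hu), ?_⟩
      rw [zigzag_neg_natCast] at h ⊢
      rw [pow_succ', map_mul, map_mul, Module.End.mul_apply, h, theta_bX, map_mul, rep_xm, rep_zp,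
        Module.End.mul_apply]
      change loweringOp q p ((X : K[X]) • (Pi.single (-(k : ℤ)) u : ℤ → K[X])) = _
      rw [← Pi.single_smul, loweringOp, weightedShift_single]
      have h1 : -(k : ℤ) - 1 = -((k + 1 : ℕ) : ℤ) := by push_cast; ring
      have h2 : -((k + 1 : ℕ) : ℤ) ≤ -1 := by omega
      rw [h1, if_pos h2, one_mul, smul_eq_mul]

theorem theta_injective (hq : q ≠ 0) : Function.Injective (theta q p) := by
  choose u hu h using exists_rep_theta_zigzag p hq
  have key (F : ℤ →₀ K[X]) (m : ℤ) :
      rep p hq (theta q p (normalForm q p F)) (Pi.single 0 1) m = expand K 2 (F m) * u m := by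
    induction F using Finsupp.induction_linear with
    | zero => simp
    | add F G hF hG => simp [hF, hG, add_mul]
    | single n f =>
      rw [normalForm_single, map_mul, map_mul, Module.End.mul_apply, h, rep_theta_aeval_bZ]
      obtain rfl | hm := eq_or_ne m n
      · simp
      · simp [hm]
  rw [injective_iff_map_eq_zero]
  intro b hb
  obtain ⟨F, rfl⟩ := normalForm_surjective q p b
  have : F = 0 := by
    ext1 m
    have := key F m
    rw [hb, map_zero] at this
    simpa [hu m, expand_eq_zero two_pos] using this.symm
  rw [this, map_zero]

end Representation

section DegreeZero

variable (q : K) (p : K[X])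

/-- The span of the normally ordered monomials of degree `n` in `A(p;q)`. -/
def orderedSpan (n : ℤ) : Submodule K (GWA K q p) :=
  Submodule.span K {a | ∃ (i j : ℕ) (k : ℤ), (i : ℤ) - j + k = n ∧
    a = zp K q p ^ i * zm K q p ^ j * zigzag (xp K q p) (xm K q p) k}

variable {q p}

theorem monomial_mem_orderedSpan {n : ℤ} (i j : ℕ) (k : ℤ) (h : (i : ℤ) - j + k = n) :
    zp K q p ^ i * zm K q p ^ j * zigzag (xp K q p) (xm K q p) k ∈ orderedSpan q p n :=
  Submodule.subset_span ⟨i, j, k, h, rfl⟩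

theorem mul_mem_orderedSpan {a : GWA K q p} {d n : ℤ}
    (h : ∀ (i j : ℕ) (k : ℤ), (i : ℤ) - j + k = n →
      a * (zp K q p ^ i * zm K q p ^ j * zigzag (xp K q p) (xm K q p) k) ∈ orderedSpan q p d)
    {b : GWA K q p} (hb : b ∈ orderedSpan q p n) : a * b ∈ orderedSpan q p d := by
  induction hb using Submodule.span_induction with
  | mem b hb =>
    obtain ⟨i, j, k, hk, rfl⟩ := hb
    exact h i j k hk
  | zero => simp
  | add b c _ _ hb hc => rw [mul_add]; exact add_mem hb hc
  | smul r b _ hb => rw [mul_smul_comm]; exact Submodule.smul_mem _ r hb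

theorem zp_mul_mem_orderedSpan {n : ℤ} {b : GWA K q p} (hb : b ∈ orderedSpan q p n) :
    zp K q p * b ∈ orderedSpan q p (n + 1) := by
  refine mul_mem_orderedSpan (fun i j k h => ?_) hb
  rw [← mul_assoc, ← mul_assoc, ← pow_succ']
  exact monomial_mem_orderedSpan _ _ _ (by push_cast; omega)

theorem zm_mul_mem_orderedSpan {n : ℤ} {b : GWA K q p} (hb : b ∈ orderedSpan q p n) :
    zm K q p * b ∈ orderedSpan q p (n - 1) := by
  refine mul_mem_orderedSpan (fun i j k h => ?_) hb
  have hc : Commute (zm K q p) (zp K q p ^ i) :=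
    Commute.pow_right (zp_mul_zm q p).symm i
  rw [← mul_assoc, ← mul_assoc, hc.eq, mul_assoc _ (zm K q p), ← pow_succ']
  exact monomial_mem_orderedSpan _ _ _ (by push_cast; omega)

theorem aeval_mul_mem_orderedSpan (c : K) (f : K[X]) {n : ℤ} {b : GWA K q p}
    (hb : b ∈ orderedSpan q p n) :
    aeval (c • (zm K q p * zp K q p)) f * b ∈ orderedSpan q p n := by
  have hpow (k : ℕ) : (c • (zm K q p * zp K q p)) ^ k * b ∈ orderedSpan q p n := by
    induction k with
    | zero => simpa
    | succ k ih =>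
      rw [pow_succ', mul_assoc, smul_mul_assoc, mul_assoc]
      simpa using Submodule.smul_mem _ c (zm_mul_mem_orderedSpan (zp_mul_mem_orderedSpan ih))
  rw [aeval_eq_sum_range, Finset.sum_mul]
  refine Submodule.sum_mem _ fun k _ => ?_
  rw [smul_mul_assoc]
  exact Submodule.smul_mem _ _ (hpow k)

theorem aeval_mul_monomial_mem_orderedSpan (c : K) (f : K[X]) {n : ℤ} (i j : ℕ) (k : ℤ)
    (h : (i : ℤ) - j + k = n) :
    zp K q p ^ i * zm K q p ^ j *
      (aeval (c • (zm K q p * zp K q p)) f * zigzag (xp K q p) (xm K q p) k) ∈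
        orderedSpan q p n := by
  have hz : Commute (zp K q p ^ i * zm K q p ^ j) (c • (zm K q p * zp K q p)) :=
    (((commute_zp_zm_mul_zp q p).pow_left i).mul_left
      ((commute_zm_zm_mul_zp q p).pow_left j)).smul_right c
  rw [← mul_assoc, (semiconjBy_aeval hz f).eq, mul_assoc]
  exact aeval_mul_mem_orderedSpan c f (monomial_mem_orderedSpan i j k h)

theorem xp_mul_mem_orderedSpan {n : ℤ} {b : GWA K q p} (hb : b ∈ orderedSpan q p n) :
    xp K q p * b ∈ orderedSpan q p (n + 1) := by
  refine mul_mem_orderedSpan (fun i j k h => ?_) hb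
  have hs := ((xp_mul_zp q p).pow_right i).mul_right ((xp_mul_zm q p).pow_right j)
  rw [← mul_assoc, hs.eq, _root_.smul_pow, _root_.smul_pow, smul_mul_smul_comm, smul_mul_assoc, smul_mul_assoc,
    mul_assoc]
  refine Submodule.smul_mem _ _ ?_
  obtain hk | hk := le_or_gt 0 k
  · rw [mul_zigzag_of_nonneg _ _ hk]
    exact monomial_mem_orderedSpan _ _ _ (by omega)
  · rw [mul_zigzag_of_neg _ _ hk, xp_mul_xm, ← one_smul K (zm K q p * zp K q p)]
    exact aeval_mul_monomial_mem_orderedSpan _ _ _ _ _ (by omega)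

theorem xm_mul_mem_orderedSpan {n : ℤ} {b : GWA K q p} (hb : b ∈ orderedSpan q p n) :
    xm K q p * b ∈ orderedSpan q p (n - 1) := by
  refine mul_mem_orderedSpan (fun i j k h => ?_) hb
  have hs := ((xm_mul_zp q p).pow_right i).mul_right ((xm_mul_zm q p).pow_right j)
  rw [← mul_assoc, hs.eq, _root_.smul_pow, _root_.smul_pow, smul_mul_smul_comm, smul_mul_assoc, smul_mul_assoc,
    mul_assoc]
  refine Submodule.smul_mem _ _ ?_
  obtain hk | hk := le_or_gt k 0
  · rw [mul_zigzag_of_nonpos _ _ hk]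
    exact monomial_mem_orderedSpan _ _ _ (by omega)
  · rw [mul_zigzag_of_pos _ _ hk, xm_mul_xp]
    exact aeval_mul_monomial_mem_orderedSpan _ _ _ _ _ (by omega)

theorem wordVal_mem_orderedSpan (w : List (Fin 4)) :
    wordVal K q p w ∈ orderedSpan q p (wordDeg w) := by
  induction w with
  | nil => simpa [wordVal, wordDeg, zigzag] using
      monomial_mem_orderedSpan (q := q) (p := p) 0 0 0 rfl
  | cons i w ih =>
    have hv : wordVal K q p (i :: w) = gwaGen K q p i * wordVal K q p w := by simp [wordVal]
    have hd : wordDeg (i :: w) = wordDeg w + gwaWt i := by simp [wordDeg, add_comm]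
    rw [hv, hd]
    fin_cases i
    · exact xp_mul_mem_orderedSpan ih
    · exact xm_mul_mem_orderedSpan ih
    · exact zp_mul_mem_orderedSpan ih
    · exact zm_mul_mem_orderedSpan ih

theorem component_le_orderedSpan (n : ℤ) : component K q p n ≤ orderedSpan q p n := by
  refine Submodule.span_le.2 ?_
  rintro _ ⟨w, rfl, rfl⟩
  exact wordVal_mem_orderedSpan w

theorem orderedSpan_zero_le_range_theta (hq : q ≠ 0) :
    orderedSpan q p 0 ≤ Subalgebra.toSubmodule (theta q p).range := by
  refine Submodule.span_le.2 ?_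
  rintro _ ⟨i, j, k, h, rfl⟩
  have hx : xm K q p * zp K q p ∈ (theta q p).range := ⟨_, theta_bX q p⟩
  have hy : zm K q p * xp K q p ∈ (theta q p).range := ⟨_, theta_bY q p⟩
  have hz : zm K q p * zp K q p ∈ (theta q p).range := ⟨_, theta_bZ q p⟩
  have hc : Commute (zp K q p) (zm K q p) := zp_mul_zm q p
  change _ ∈ (theta q p).range
  obtain ⟨k, rfl | rfl⟩ := k.eq_nat_or_neg
  · obtain rfl : j = i + k := by omega
    rw [zigzag_natCast, pow_add, ← mul_assoc, ← hc.mul_pow, mul_assoc, hc.eq]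
    refine mul_mem (pow_mem hz i) (pow_mul_pow_mem (c := q) hy ?_ k)
    rw [(xp_mul_zm q p).eq, smul_mul_assoc, smul_inv_smul₀ hq]
  · obtain rfl : i = j + k := by omega
    rw [zigzag_neg_natCast, pow_add, mul_assoc (_ ^ j), (hc.pow_pow k j).eq, ← mul_assoc,
      ← hc.mul_pow, mul_assoc, hc.eq]
    have h1 : zp K q p * xm K q p = q⁻¹ • (xm K q p * zp K q p) := by
      rw [(xm_mul_zp q p).eq, smul_mul_assoc, inv_smul_smul₀ hq]
    exact mul_mem (pow_mem hz j)
      (pow_mul_pow_mem (h1 ▸ Subalgebra.smul_mem _ hx _) h1 k)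

theorem mul_mem_component {m n : ℤ} {a b : GWA K q p} (ha : a ∈ component K q p m)
    (hb : b ∈ component K q p n) : a * b ∈ component K q p (m + n) := by
  have h := Submodule.mul_mem_mul ha hb
  rw [component, component, Submodule.span_mul_span] at h
  refine Submodule.span_mono ?_ h
  rintro _ ⟨_, ⟨w, rfl, rfl⟩, _, ⟨w', rfl, rfl⟩, rfl⟩
  exact ⟨w ++ w', by simp [wordDeg], by simp [wordVal]⟩

theorem gwaGen_mem_component (i : Fin 4) : gwaGen K q p i ∈ component K q p (gwaWt i) :=
  Submodule.subset_span ⟨[i], by simp [wordDeg], by simp [wordVal]⟩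

theorem xp_mem_component : xp K q p ∈ component K q p 1 :=
  gwaGen_mem_component 0

theorem xm_mem_component : xm K q p ∈ component K q p (-1) :=
  gwaGen_mem_component 1

theorem zp_mem_component : zp K q p ∈ component K q p 1 :=
  gwaGen_mem_component 2

theorem zm_mem_component : zm K q p ∈ component K q p (-1) :=
  gwaGen_mem_component 3

theorem theta_mem_component (b : GWB K q p) : theta q p b ∈ component K q p 0 := by
  obtain ⟨a, rfl⟩ := RingQuot.mkAlgHom_surjective K (GWBRel K q p) b
  induction a using FreeAlgebra.induction with
  | grade0 r =>
    rw [AlgHom.commutes, AlgHom.commutes, Algebra.algebraMap_eq_smul_one]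
    exact Submodule.smul_mem _ r (Submodule.subset_span ⟨[], rfl, rfl⟩)
  | grade1 i =>
    match i with
    | 0 =>
      have h := mul_mem_component (xm_mem_component (q := q) (p := p)) zp_mem_component
      rwa [← theta_bX, neg_add_cancel] at h
    | 1 =>
      have h := mul_mem_component (zm_mem_component (q := q) (p := p)) xp_mem_component
      rwa [← theta_bY, neg_add_cancel] at h
    | 2 =>
      have h := mul_mem_component (zm_mem_component (q := q) (p := p)) zp_mem_component
      rwa [← theta_bZ, neg_add_cancel] at h
  | mul a a' h h' => simpa only [map_mul, zero_add] using mul_mem_component h h'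
  | add a a' h h' => rw [map_add, map_add]; exact add_mem h h'

end DegreeZero

variable (K)

/-- The algebra map `Θ: B(p;q) → A(p;q)`, `x ↦ x₋z₊`, `y ↦ z₋x₊`,
`z ↦ z₋z₊`, is well defined and is an isomorphism of `B(p;q)` onto the degree-zero
component `A(p;q)₀`. -/
theorem theta_isomorphism [CharZero K]
    (q : K) (hq : q ≠ 0) (p : K[X])
    :
    ∃ Θ : GWB K q p →ₐ[K] GWA K q p,
      Θ (bX K q p) = xm K q p * zp K q p ∧
      Θ (bY K q p) = zm K q p * xp K q p ∧
      Θ (bZ K q p) = zm K q p * zp K q p ∧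
      Function.Injective Θ ∧
      Set.range Θ = (component K q p 0 : Set (GWA K q p)) := by
  refine ⟨theta q p, theta_bX q p, theta_bY q p, theta_bZ q p, theta_injective p hq, ?_⟩
  refine Set.Subset.antisymm ?_ ?_
  · rintro _ ⟨b, rfl⟩
    exact theta_mem_component b
  · intro a ha
    exact orderedSpan_zero_le_range_theta hq (component_le_orderedSpan 0 ha)

end GWAPaper
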